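/- For every s > 1/2 there is C > 0 such that for all n ∈ ℕ, all t ∈ ℝ, and all v, w : ℤ → ℂ with ‖v‖_{H^s}, ‖w‖_{H^s} < ∞: ‖N₂^{(−n)}(v)(t)‖_{H^s} ≤ C ‖v‖⁵_{H^s}, and ‖N₂^{(−n)}(v)(t) − N₂^{(−n)}(w)(t)‖_{H^s} ≤ C (‖v‖_{H^s} + ‖w‖_{H^s})⁴ ‖v − w‖_{H^s}; the same two bounds hold for the unrestricted expression N₂ in place of N₂^{(−n)}. -/

import Mathlib

open scoped ENNReal

/-- Japanese bracket `⟨k⟩ = 1 + |k|`. -/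
noncomputable def jb (k : ℤ) : ℝ := 1 + |(k : ℝ)|

/-- `‖f‖_{H^s} = (∑_k ⟨k⟩^{2s} |f k|²)^{1/2}`, valued in `[0,∞]`. -/
noncomputable def hnorm (s : ℝ) (f : ℤ → ℂ) : ℝ≥0∞ :=
  (∑' k : ℤ, ENNReal.ofReal (jb k ^ (2 * s) * ‖f k‖ ^ 2)) ^ (1 / 2 : ℝ)

/-- `Φ(k̄) = k³ − k₁³ − k₂³ − k₃³` with `k = k₁ + k₂ + k₃`. -/
def Phi (k₁ k₂ k₃ : ℤ) : ℤ := (k₁ + k₂ + k₃) ^ 3 - k₁ ^ 3 - k₂ ^ 3 - k₃ ^ 3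

/-- Cubic summand of `N₂(v)(t)_k`, parametrized by `(k₁, k₂)` with `k₃ = k - k₁ - k₂`. -/
noncomputable def N2term1 (v : ℤ → ℂ) (t : ℝ) (k : ℤ) (p : ℤ × ℤ) : ℂ :=
  if Phi p.1 p.2 (k - p.1 - p.2) ≠ 0 then
    -(((k : ℂ) * (p.1 : ℂ)) / (Complex.I * ((Phi p.1 p.2 (k - p.1 - p.2) : ℤ) : ℂ))) *
      Complex.exp (Complex.I * (t : ℂ) * ((Phi p.1 p.2 (k - p.1 - p.2) : ℤ) : ℂ)) *
      (‖v p.1‖ : ℂ) ^ 2 * v p.1 * v p.2 * v (k - p.1 - p.2)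
  else 0

/-- Quintic summand of `N₂(v)(t)_k`, parametrized by `(k₁, k₂, j₁, j₂)` with
`k₃ = k - k₁ - k₂` and `j₃ = k₁ - j₁ - j₂`. -/
noncomputable def N2term2 (v : ℤ → ℂ) (t : ℝ) (k : ℤ) (q : ℤ × ℤ × ℤ × ℤ) : ℂ :=
  if Phi q.1 q.2.1 (k - q.1 - q.2.1) ≠ 0 ∧
      Phi q.2.2.1 q.2.2.2 (q.1 - q.2.2.1 - q.2.2.2) ≠ 0 then
    (1 / 3 : ℂ) *
      (((k : ℂ) * (q.1 : ℂ)) / (Complex.I * ((Phi q.1 q.2.1 (k - q.1 - q.2.1) : ℤ) : ℂ))) *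
      Complex.exp (Complex.I * (t : ℂ) *
        (((Phi q.1 q.2.1 (k - q.1 - q.2.1) : ℤ) : ℂ) +
          ((Phi q.2.2.1 q.2.2.2 (q.1 - q.2.2.1 - q.2.2.2) : ℤ) : ℂ))) *
      v q.2.2.1 * v q.2.2.2 * v (q.1 - q.2.2.1 - q.2.2.2) * v q.2.1 * v (k - q.1 - q.2.1)
  else 0

/-- `N₂(v)(t)_k`, arising from differentiation by parts. -/
noncomputable def N2 (v : ℤ → ℂ) (t : ℝ) (k : ℤ) : ℂ :=
  (∑' p : ℤ × ℤ, N2term1 v t k p) + ∑' q : ℤ × ℤ × ℤ × ℤ, N2term2 v t k q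

/-- `N₂^{(-n)}(v)(t)_k`: the part of `N₂` with `max(|k₁|,|k₂|,|k₃|) > n`. -/
noncomputable def N2n (n : ℕ) (v : ℤ → ℂ) (t : ℝ) (k : ℤ) : ℂ :=
  (∑' p : ℤ × ℤ,
    if (n : ℤ) < max (max |p.1| |p.2|) |k - p.1 - p.2| then N2term1 v t k p else 0) +
  ∑' q : ℤ × ℤ × ℤ × ℤ,
    if (n : ℤ) < max (max |q.1| |q.2.1|) |k - q.1 - q.2.1| then N2term2 v t k q else 0

open MeasureTheory

/-- The weight `⟨k⟩^s` as an extended nonnegative real. -/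
noncomputable def sobWeight (s : ℝ) (k : ℤ) : ℝ≥0∞ := ENNReal.ofReal (jb k ^ s)

/-- The `H^s` norm of an `[0,∞]`-valued sequence. -/
noncomputable def sobNorm (s : ℝ) (f : ℤ → ℝ≥0∞) : ℝ≥0∞ :=
  (∑' k, (sobWeight s k * f k) ^ 2) ^ (1 / 2 : ℝ)

/-- The positive trilinear convolution operator with kernel `m`. -/
noncomputable def trilin (m : ℤ → ℤ × ℤ → ℝ≥0∞) (f g h : ℤ → ℝ≥0∞) (k : ℤ) : ℝ≥0∞ :=
  ∑' p : ℤ × ℤ, m k p * (f p.1 * g p.2 * h (k - p.1 - p.2))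

/-- The Schur-type condition making `trilin m` bounded on `H^s` with constant `B`. -/
def KernelBound (s : ℝ) (m : ℤ → ℤ × ℤ → ℝ≥0∞) (B : ℝ≥0∞) : Prop :=
  ∀ k, ∑' p : ℤ × ℤ, (m k p * (sobWeight s k * sobWeight (-s) p.1 * sobWeight (-s) p.2 *
    sobWeight (-s) (k - p.1 - p.2))) ^ 2 ≤ B ^ 2

lemma one_le_jb (k : ℤ) : 1 ≤ jb k := by
  unfold jb; linarith [abs_nonneg (k : ℝ)]

lemma jb_pos (k : ℤ) : 0 < jb k := lt_of_lt_of_le one_pos (one_le_jb k)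

lemma one_le_sobWeight {s : ℝ} (hs : 0 ≤ s) (k : ℤ) : 1 ≤ sobWeight s k := by
  unfold sobWeight
  rw [ENNReal.one_le_ofReal]
  exact Real.one_le_rpow (one_le_jb k) hs

lemma sobWeight_neg_mul (s : ℝ) (k : ℤ) : sobWeight (-s) k * sobWeight s k = 1 := by
  unfold sobWeight
  rw [← ENNReal.ofReal_mul (Real.rpow_nonneg (jb_pos k).le _), ← Real.rpow_add (jb_pos k)]
  simp

lemma hnorm_eq_sobNorm (s : ℝ) (f : ℤ → ℂ) : hnorm s f = sobNorm s (fun k => ‖f k‖ₑ) := by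
  unfold hnorm sobNorm sobWeight
  congr 1
  refine tsum_congr fun k => ?_
  beta_reduce
  rw [← ofReal_norm, ← ENNReal.ofReal_mul (Real.rpow_nonneg (jb_pos k).le _),
    ← ENNReal.ofReal_pow (mul_nonneg (Real.rpow_nonneg (jb_pos k).le _) (norm_nonneg _)), mul_pow,
    mul_comm 2 s, Real.rpow_mul (jb_pos k).le, Real.rpow_two]

lemma sobNorm_mono {s : ℝ} {f g : ℤ → ℝ≥0∞} (h : ∀ k, f k ≤ g k) : sobNorm s f ≤ sobNorm s g := by
  unfold sobNorm
  gcongr with k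
  exact h k

lemma sobNorm_const_mul (s : ℝ) (c : ℝ≥0∞) (f : ℤ → ℝ≥0∞) :
    sobNorm s (fun k => c * f k) = c * sobNorm s f := by
  unfold sobNorm
  have : ∀ k, (sobWeight s k * (c * f k)) ^ 2 = c ^ 2 * (sobWeight s k * f k) ^ 2 := fun k => by ring
  simp_rw [this, ENNReal.tsum_mul_left]
  rw [ENNReal.mul_rpow_of_nonneg _ _ (by norm_num), ← ENNReal.rpow_natCast, ← ENNReal.rpow_mul]
  norm_num

lemma sobNorm_add_le (s : ℝ) (f g : ℤ → ℝ≥0∞) :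
    sobNorm s (fun k => f k + g k) ≤ sobNorm s f + sobNorm s g := by
  have := ENNReal.lintegral_Lp_add_le (μ := Measure.count) (p := 2)
    (f := fun k => sobWeight s k * f k) (g := fun k => sobWeight s k * g k)
    (measurable_of_countable _).aemeasurable (measurable_of_countable _).aemeasurable (by norm_num)
  simpa [lintegral_count, sobNorm, mul_add] using this

lemma le_sobNorm {s : ℝ} (hs : 0 ≤ s) (f : ℤ → ℝ≥0∞) (k : ℤ) : f k ≤ sobNorm s f := by
  unfold sobNorm
  calc f k = (f k ^ 2) ^ (1 / 2 : ℝ) := by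
        rw [← ENNReal.rpow_natCast, ← ENNReal.rpow_mul]; norm_num
    _ ≤ ((sobWeight s k * f k) ^ 2) ^ (1 / 2 : ℝ) := by
        gcongr
        exact le_mul_of_one_le_left (by positivity) (one_le_sobWeight hs k)
    _ ≤ _ := by
        gcongr
        exact ENNReal.le_tsum (f := fun k => (sobWeight s k * f k) ^ 2) k

lemma sq_tsum_mul_le {ι : Type*} [Countable ι] (f g : ι → ℝ≥0∞) :
    (∑' i, f i * g i) ^ 2 ≤ (∑' i, f i ^ 2) * ∑' i, g i ^ 2 := by
  let _ : MeasurableSpace ι := ⊤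
  have := ENNReal.lintegral_mul_le_Lp_mul_Lq (Measure.count : Measure ι)
    (Real.HolderConjugate.two_two) (f := f) (g := g)
    (measurable_of_countable _).aemeasurable (measurable_of_countable _).aemeasurable
  simp only [lintegral_count, Pi.mul_apply, ENNReal.rpow_two] at this
  calc (∑' i, f i * g i) ^ 2
      ≤ ((∑' i, f i ^ 2) ^ (1 / 2 : ℝ) * (∑' i, g i ^ 2) ^ (1 / 2 : ℝ)) ^ 2 := by gcongr
    _ = _ := by
      rw [mul_pow, ← ENNReal.rpow_natCast, ← ENNReal.rpow_natCast, ← ENNReal.rpow_mul,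
        ← ENNReal.rpow_mul]
      norm_num

lemma tsum_prod_mul (f g : ℤ → ℝ≥0∞) :
    ∑' p : ℤ × ℤ, f p.1 * g p.2 = (∑' i, f i) * ∑' i, g i := by
  rw [ENNReal.tsum_prod (f := fun a b => f a * g b)]
  simp_rw [ENNReal.tsum_mul_left, ENNReal.tsum_mul_right]

lemma tsum_tsum_conv (f g h : ℤ → ℝ≥0∞) :
    ∑' k : ℤ, ∑' p : ℤ × ℤ, f p.1 * g p.2 * h (k - p.1 - p.2) =
      (∑' i, f i) * (∑' i, g i) * ∑' i, h i := by
  rw [ENNReal.tsum_comm]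
  have : ∀ p : ℤ × ℤ, ∑' k : ℤ, f p.1 * g p.2 * h (k - p.1 - p.2) =
      f p.1 * g p.2 * ∑' i, h i := fun p => by
    rw [ENNReal.tsum_mul_left]
    congr 1
    have := (Equiv.subRight (p.1 + p.2)).tsum_eq h
    simpa [sub_sub] using this
  simp_rw [this, ENNReal.tsum_mul_right, tsum_prod_mul]

lemma sobNorm_trilin_le {s : ℝ} {m : ℤ → ℤ × ℤ → ℝ≥0∞} {B : ℝ≥0∞} (hm : KernelBound s m B)
    (f g h : ℤ → ℝ≥0∞) :
    sobNorm s (trilin m f g h) ≤ B * (sobNorm s f * sobNorm s g * sobNorm s h) := by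
  let F : (ℤ → ℝ≥0∞) → ℤ → ℝ≥0∞ := fun f k => (sobWeight s k * f k) ^ 2
  have key : ∑' k, (sobWeight s k * trilin m f g h k) ^ 2 ≤
      B ^ 2 * ((∑' i, F f i) * (∑' i, F g i) * ∑' i, F h i) := by
    rw [← tsum_tsum_conv, ← ENNReal.tsum_mul_left]
    refine ENNReal.tsum_le_tsum fun k => ?_
    have e : sobWeight s k * trilin m f g h k = ∑' p : ℤ × ℤ,
        (m k p * (sobWeight s k * sobWeight (-s) p.1 * sobWeight (-s) p.2 *
          sobWeight (-s) (k - p.1 - p.2))) *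
        ((sobWeight s p.1 * f p.1) * (sobWeight s p.2 * g p.2) *
          (sobWeight s (k - p.1 - p.2) * h (k - p.1 - p.2))) := by
      rw [trilin, ← ENNReal.tsum_mul_left]
      refine tsum_congr fun p => ?_
      calc _ = (sobWeight (-s) p.1 * sobWeight s p.1) * (sobWeight (-s) p.2 * sobWeight s p.2) *
            (sobWeight (-s) (k - p.1 - p.2) * sobWeight s (k - p.1 - p.2)) *
            (sobWeight s k * (m k p * (f p.1 * g p.2 * h (k - p.1 - p.2)))) := by
              simp [sobWeight_neg_mul]
        _ = _ := by ring
    rw [e]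
    refine (sq_tsum_mul_le _ _).trans ?_
    refine mul_le_mul' (hm k) (le_of_eq (tsum_congr fun p => ?_))
    simp only [F]
    ring
  unfold sobNorm
  calc _ ≤ (B ^ 2 * ((∑' i, F f i) * (∑' i, F g i) * ∑' i, F h i)) ^ (1 / 2 : ℝ) := by gcongr
    _ = _ := by
      simp only [ENNReal.mul_rpow_of_nonneg _ _ (show (0 : ℝ) ≤ 1 / 2 by norm_num), F]
      rw [← ENNReal.rpow_natCast B, ← ENNReal.rpow_mul]
      norm_num

/-- The modulus of the multiplier `k k₁ / (i Φ)` on its nonresonant support. -/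
noncomputable def mult (k : ℤ) (p : ℤ × ℤ) : ℝ≥0∞ :=
  if Phi p.1 p.2 (k - p.1 - p.2) ≠ 0 then
    ‖((k : ℂ) * (p.1 : ℂ)) / (Complex.I * ((Phi p.1 p.2 (k - p.1 - p.2) : ℤ) : ℂ))‖ₑ
  else 0

/-- `∑_{pairs} ⟨x⟩⁻²⟨y⟩⁻²` over the pairs among `k₂ + k₃`, `k₃ + k₁`, `k₁ + k₂`. -/
noncomputable def pairSum (k : ℤ) (p : ℤ × ℤ) : ℝ :=
  jb (k - p.1) ^ (-(2 : ℝ)) * jb (k - p.2) ^ (-(2 : ℝ)) +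
  jb (k - p.1) ^ (-(2 : ℝ)) * jb (p.1 + p.2) ^ (-(2 : ℝ)) +
  jb (k - p.2) ^ (-(2 : ℝ)) * jb (p.1 + p.2) ^ (-(2 : ℝ))

lemma pairSum_nonneg (k : ℤ) (p : ℤ × ℤ) : 0 ≤ pairSum k p := by
  have := fun x => (Real.rpow_pos_of_pos (jb_pos x) (-(2 : ℝ))).le
  unfold pairSum
  have h₁ := this (k - p.1)
  have h₂ := this (k - p.2)
  have h₃ := this (p.1 + p.2)
  positivity

lemma jb_le_add (k a b : ℤ) : jb k ≤ jb a + jb b + jb (k - a - b) := by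
  unfold jb
  push_cast
  have h1 := abs_add_le ((a : ℝ) + b) ((k : ℝ) - a - b)
  have h2 := abs_add_le (a : ℝ) b
  have e : (a : ℝ) + b + (k - a - b) = k := by ring
  rw [e] at h1
  linarith

lemma weighted_sq_le_of_le {s c M P X X₁ X₂ X₃ : ℝ} (hs : 1 / 2 < s) (hc : 0 ≤ c)
    (hP : 0 ≤ P) (hX : 1 ≤ X) (h₁ : 1 ≤ X₁) (h₂ : 1 ≤ X₂) (h₃ : 1 ≤ X₃) (hle : X ≤ 3 * X₁)
    (hM : M ^ 2 ≤ c * (1 + X₂ * X₃ * P)) :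
    (M * (X ^ s * X₁ ^ (-s) * X₂ ^ (-s) * X₃ ^ (-s))) ^ 2 ≤
      c * 9 ^ s * (X₂ ^ (-(2 * s)) * X₃ ^ (-(2 * s)) + P) := by
  have sq : ∀ x : ℝ, 1 ≤ x → (x ^ (-s)) ^ 2 = x ^ (-(2 * s)) := fun x hx => by
    rw [← Real.rpow_two, ← Real.rpow_mul (by linarith)]; congr 1; ring
  have dec : ∀ x : ℝ, 1 ≤ x → x * x ^ (-(2 * s)) ≤ 1 := fun x hx => by
    rw [← Real.rpow_one_add' (by linarith) (by linarith)]
    exact Real.rpow_le_one_of_one_le_of_nonpos hx (by linarith)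
  have nn : ∀ x : ℝ, 1 ≤ x → 0 < x ^ (-(2 * s)) := fun x hx => Real.rpow_pos_of_pos (by linarith) _
  have hr : (X ^ s * X₁ ^ (-s)) ^ 2 ≤ 9 ^ s := by
    have : X ^ s * X₁ ^ (-s) ≤ 3 ^ s := by
      calc X ^ s * X₁ ^ (-s) ≤ (3 * X₁) ^ s * X₁ ^ (-s) := by
            have : 0 < X₁ ^ (-s) := Real.rpow_pos_of_pos (by linarith) _
            gcongr
        _ = 3 ^ s := by
            rw [Real.mul_rpow (by norm_num) (by linarith), mul_assoc,
              ← Real.rpow_add (by linarith)]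
            simp
    calc _ ≤ ((3 : ℝ) ^ s) ^ 2 := by
          have : 0 < X₁ ^ (-s) := Real.rpow_pos_of_pos (by linarith) _
          have : 0 < X ^ s := Real.rpow_pos_of_pos (by linarith) _
          gcongr
      _ = 9 ^ s := by
          rw [← Real.rpow_two, ← Real.rpow_mul (by norm_num), mul_comm, Real.rpow_mul (by norm_num)]
          norm_num
  have n2 := nn X₂ h₂
  have n3 := nn X₃ h₃
  calc _ = M ^ 2 * (X ^ s * X₁ ^ (-s)) ^ 2 * ((X₂ ^ (-s)) ^ 2 * (X₃ ^ (-s)) ^ 2) := by ring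
    _ = M ^ 2 * (X ^ s * X₁ ^ (-s)) ^ 2 * (X₂ ^ (-(2 * s)) * X₃ ^ (-(2 * s))) := by
        rw [sq _ h₂, sq _ h₃]
    _ ≤ (c * (1 + X₂ * X₃ * P)) * 9 ^ s * (X₂ ^ (-(2 * s)) * X₃ ^ (-(2 * s))) := by
        gcongr
    _ = c * 9 ^ s * (X₂ ^ (-(2 * s)) * X₃ ^ (-(2 * s)) +
          (X₂ * X₂ ^ (-(2 * s))) * (X₃ * X₃ ^ (-(2 * s))) * P) := by ring
    _ ≤ c * 9 ^ s * (X₂ ^ (-(2 * s)) * X₃ ^ (-(2 * s)) + 1 * 1 * P) := by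
        gcongr
        · exact dec _ h₂
        · exact dec _ h₃
    _ = _ := by ring

lemma weighted_sq_le {s c M P X X₁ X₂ X₃ : ℝ} (hs : 1 / 2 < s) (hc : 0 ≤ c)
    (hP : 0 ≤ P) (hX : 1 ≤ X) (h₁ : 1 ≤ X₁) (h₂ : 1 ≤ X₂) (h₃ : 1 ≤ X₃) (hle : X ≤ X₁ + X₂ + X₃)
    (hM₁ : M ^ 2 ≤ c * (1 + X₂ * X₃ * P)) (hM₂ : M ^ 2 ≤ c * (1 + X₁ * X₃ * P))
    (hM₃ : M ^ 2 ≤ c * (1 + X₁ * X₂ * P)) :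
    (M * (X ^ s * X₁ ^ (-s) * X₂ ^ (-s) * X₃ ^ (-s))) ^ 2 ≤
      c * 9 ^ s * (X₂ ^ (-(2 * s)) * X₃ ^ (-(2 * s)) + X₁ ^ (-(2 * s)) * X₃ ^ (-(2 * s)) +
        X₁ ^ (-(2 * s)) * X₂ ^ (-(2 * s)) + P) := by
  have nn : ∀ x : ℝ, 1 ≤ x → 0 < x ^ (-(2 * s)) := fun x hx => Real.rpow_pos_of_pos (by linarith) _
  have n1 := nn X₁ h₁
  have n2 := nn X₂ h₂
  have n3 := nn X₃ h₃
  have n12 := mul_pos n1 n2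
  have n13 := mul_pos n1 n3
  have n23 := mul_pos n2 n3
  have c9 : 0 ≤ c * 9 ^ s := by positivity
  have : X ≤ 3 * X₁ ∨ X ≤ 3 * X₂ ∨ X ≤ 3 * X₃ := by
    by_contra! h; linarith [h.1, h.2.1, h.2.2]
  rcases this with h | h | h
  · refine (weighted_sq_le_of_le hs hc hP hX h₁ h₂ h₃ h hM₁).trans ?_
    gcongr; linarith
  · have := weighted_sq_le_of_le hs hc hP hX h₂ h₁ h₃ h hM₂
    rw [mul_right_comm (X ^ s)] at this
    refine this.trans ?_
    gcongr; linarith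
  · have := weighted_sq_le_of_le hs hc hP hX h₃ h₁ h₂ h hM₃
    rw [mul_right_comm (X ^ s), mul_right_comm (X ^ s * _)] at this
    refine this.trans ?_
    gcongr; linarith

lemma tsum_jb_rpow_ne_top {r : ℝ} (hr : 1 < r) :
    ∑' k : ℤ, ENNReal.ofReal (jb k ^ (-r)) ≠ ⊤ := by
  apply Summable.tsum_ofReal_ne_top
  have := Real.summable_abs_int_rpow hr
  refine Summable.of_norm_bounded_eventually this ?_
  rw [Filter.eventually_cofinite]
  refine (Set.finite_singleton (0 : ℤ)).subset fun k hk => ?_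
  by_contra h0
  apply hk
  have hp : 0 < |(k : ℝ)| := abs_pos.2 (by exact_mod_cast h0)
  rw [Real.norm_of_nonneg (Real.rpow_nonneg (jb_pos k).le _)]
  exact Real.rpow_le_rpow_of_nonpos hp (by unfold jb; linarith) (by linarith)

lemma tsum_pair_le (r : ℝ) (e₁ e₂ : ℤ × ℤ → ℤ) (h : Function.Injective fun p => (e₁ p, e₂ p)) :
    ∑' p : ℤ × ℤ, ENNReal.ofReal (jb (e₁ p) ^ (-r) * jb (e₂ p) ^ (-r)) ≤
      (∑' k : ℤ, ENNReal.ofReal (jb k ^ (-r))) ^ 2 := by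
  rw [sq, ← tsum_prod_mul]
  refine le_trans (le_of_eq ?_) (ENNReal.tsum_comp_le_tsum_of_injective h _)
  refine tsum_congr fun p => ?_
  rw [ENNReal.ofReal_mul (Real.rpow_nonneg (jb_pos _).le _)]

lemma exists_kernelBound {s : ℝ} (hs : 1 / 2 < s) {c : ℝ} (hc : 0 ≤ c) (M : ℤ → ℤ × ℤ → ℝ)
    (h₁ : ∀ k p, M k p ^ 2 ≤ c * (1 + jb p.2 * jb (k - p.1 - p.2) * pairSum k p))
    (h₂ : ∀ k p, M k p ^ 2 ≤ c * (1 + jb p.1 * jb (k - p.1 - p.2) * pairSum k p))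
    (h₃ : ∀ k p, M k p ^ 2 ≤ c * (1 + jb p.1 * jb p.2 * pairSum k p)) :
    ∃ B : ℝ≥0∞, B ≠ ⊤ ∧ KernelBound s (fun k p => ‖M k p‖ₑ) B := by
  set S := ∑' k : ℤ, ENNReal.ofReal (jb k ^ (-(2 * s)))
  set R := ∑' k : ℤ, ENNReal.ofReal (jb k ^ (-(2 : ℝ)))
  have hSt : S ≠ ⊤ := tsum_jb_rpow_ne_top (by linarith)
  have hRt : R ≠ ⊤ := tsum_jb_rpow_ne_top (by norm_num)
  have nn : ∀ (r : ℝ) (x : ℤ), 0 ≤ jb x ^ r := fun r x => Real.rpow_nonneg (jb_pos x).le _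
  let D : ℝ≥0∞ := ENNReal.ofReal (c * 9 ^ s) * (S ^ 2 + S ^ 2 + S ^ 2 + (R ^ 2 + R ^ 2 + R ^ 2))
  have hD : D ≠ ⊤ := by
    have : S ^ 2 ≠ ⊤ := ENNReal.pow_ne_top hSt
    have : R ^ 2 ≠ ⊤ := ENNReal.pow_ne_top hRt
    finiteness
  refine ⟨D + 1, by finiteness, fun k => ?_⟩
  have hpt : ∀ p : ℤ × ℤ, (‖M k p‖ₑ * (sobWeight s k * sobWeight (-s) p.1 * sobWeight (-s) p.2 *
      sobWeight (-s) (k - p.1 - p.2))) ^ 2 ≤ ENNReal.ofReal (c * 9 ^ s) *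
      (ENNReal.ofReal (jb p.2 ^ (-(2 * s)) * jb (k - p.1 - p.2) ^ (-(2 * s))) +
      ENNReal.ofReal (jb p.1 ^ (-(2 * s)) * jb (k - p.1 - p.2) ^ (-(2 * s))) +
      ENNReal.ofReal (jb p.1 ^ (-(2 * s)) * jb p.2 ^ (-(2 * s))) +
      (ENNReal.ofReal (jb (k - p.1) ^ (-(2 : ℝ)) * jb (k - p.2) ^ (-(2 : ℝ))) +
      ENNReal.ofReal (jb (k - p.1) ^ (-(2 : ℝ)) * jb (p.1 + p.2) ^ (-(2 : ℝ))) +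
      ENNReal.ofReal (jb (k - p.2) ^ (-(2 : ℝ)) * jb (p.1 + p.2) ^ (-(2 : ℝ))))) := by
    intro p
    have n2 := fun x y : ℤ => mul_nonneg (nn (-(2 * s)) x) (nn (-(2 * s)) y)
    have n3 := fun x y : ℤ => mul_nonneg (nn (-(2 : ℝ)) x) (nn (-(2 : ℝ)) y)
    rw [← ENNReal.ofReal_add (n2 _ _) (n2 _ _),
      ← ENNReal.ofReal_add (add_nonneg (n2 _ _) (n2 _ _)) (n2 _ _),
      ← ENNReal.ofReal_add (n3 _ _) (n3 _ _),
      ← ENNReal.ofReal_add (add_nonneg (n3 _ _) (n3 _ _)) (n3 _ _),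
      ← ENNReal.ofReal_add (add_nonneg (add_nonneg (n2 _ _) (n2 _ _)) (n2 _ _))
        (add_nonneg (add_nonneg (n3 _ _) (n3 _ _)) (n3 _ _)),
      ← ENNReal.ofReal_mul (by positivity), ← ofReal_norm]
    unfold sobWeight
    rw [← ENNReal.ofReal_mul (nn _ _), ← ENNReal.ofReal_mul (mul_nonneg (nn _ _) (nn _ _)),
      ← ENNReal.ofReal_mul (mul_nonneg (mul_nonneg (nn _ _) (nn _ _)) (nn _ _)),
      ← ENNReal.ofReal_mul (norm_nonneg _), ← ENNReal.ofReal_pow (mul_nonneg (norm_nonneg _)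
        (mul_nonneg (mul_nonneg (mul_nonneg (nn _ _) (nn _ _)) (nn _ _)) (nn _ _)))]
    apply ENNReal.ofReal_le_ofReal
    refine weighted_sq_le hs hc (pairSum_nonneg k p) (one_le_jb _) (one_le_jb _) (one_le_jb _)
      (one_le_jb _) (jb_le_add _ _ _) ?_ ?_ ?_
    all_goals rw [Real.norm_eq_abs, sq_abs]
    · exact h₁ k p
    · exact h₂ k p
    · exact h₃ k p
  refine (ENNReal.tsum_le_tsum hpt).trans ?_
  rw [ENNReal.tsum_mul_left]
  simp only [ENNReal.tsum_add]
  have inj : ∀ e : ℤ × ℤ → ℤ × ℤ, (∀ p q, (e p).1 = (e q).1 → (e p).2 = (e q).2 →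
      p.1 = q.1 ∧ p.2 = q.2) → Function.Injective e := fun e h p q hpq =>
    Prod.ext_iff.2 (h p q (congrArg Prod.fst hpq) (congrArg Prod.snd hpq))
  calc _ ≤ D := by
        refine mul_le_mul' le_rfl (add_le_add (add_le_add (add_le_add ?_ ?_) ?_)
          (add_le_add (add_le_add ?_ ?_) ?_)) <;>
        refine tsum_pair_le _ _ _ (inj _ fun p q h h' => ?_) <;> dsimp only at h h' <;> omega
    _ ≤ (D + 1) * 1 := by simp
    _ ≤ (D + 1) * (D + 1) := by gcongr; simp
    _ = _ := (sq _).symm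

lemma exists_kernelBound_one {s : ℝ} (hs : 1 / 2 < s) :
    ∃ B : ℝ≥0∞, B ≠ ⊤ ∧ KernelBound s (fun _ _ => 1) B := by
  have h : ∀ k p x y, (1 : ℝ) ^ 2 ≤ 1 * (1 + jb x * jb y * pairSum k p) := fun k p x y => by
    have := mul_nonneg (mul_nonneg (jb_pos x).le (jb_pos y).le) (pairSum_nonneg k p)
    linarith
  simpa using exists_kernelBound hs zero_le_one (fun _ _ => 1) (fun k p => h k p _ _)
    (fun k p => h k p _ _) (fun k p => h k p _ _)

lemma abs_mul_le_sum_sq (x y z : ℝ) :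
    |y| * |z| ≤ ((x + y) ^ 2 + (y + z) ^ 2 + (z + x) ^ 2) / 2 := by
  rw [← abs_mul, abs_le]
  constructor <;> nlinarith [sq_nonneg (x + y), sq_nonneg (z + x), sq_nonneg (y + z),
    sq_nonneg ((x + y) - (z + x)), sq_nonneg ((x + y) + (z + x))]

lemma sq_sum_mul_le_right (x y z : ℝ) :
    ((x + y + z) * x) ^ 2 ≤ 5 * (((x + y) * (z + x)) ^ 2 +
      |y| * |z| * ((x + y) ^ 2 + (y + z) ^ 2 + (z + x) ^ 2)) := by
  have h := mul_le_mul_of_nonneg_left (abs_mul_le_sum_sq x y z)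
    (mul_nonneg (abs_nonneg y) (abs_nonneg z))
  have h' : (|y| * |z|) * (|y| * |z|) = (y * z) ^ 2 := by rw [← abs_mul, abs_mul_abs_self]; ring
  rw [h'] at h
  nlinarith [sq_nonneg ((x + y) * (z + x) + y * z), sq_nonneg ((x + y) * (z + x)),
    sq_nonneg (y * z)]

lemma sq_sum_mul_le_left (x y z : ℝ) :
    ((x + y + z) * x) ^ 2 ≤ 5 * (((x + y) * (z + x)) ^ 2 +
      |x| * |z| * ((x + y) ^ 2 + (y + z) ^ 2 + (z + x) ^ 2)) := by
  have h := mul_le_mul_of_nonneg_left (abs_mul_le_sum_sq y x z)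
    (mul_nonneg (abs_nonneg x) (abs_nonneg z))
  have h' : (|x| * |z|) * (|x| * |z|) = (x * z) ^ 2 := by rw [← abs_mul, abs_mul_abs_self]; ring
  rw [h'] at h
  have hx : x ^ 2 ≤ (z + x) ^ 2 + 2 * (|x| * |z|) := by
    have := neg_abs_le (x * z)
    rw [abs_mul] at this
    nlinarith [sq_nonneg z]
  have hx' := mul_le_mul_of_nonneg_left hx (sq_nonneg (x + y))
  have n := mul_nonneg (abs_nonneg x) (abs_nonneg z)
  have n1 := mul_nonneg n (sq_nonneg (x + y))
  have n2 := mul_nonneg n (sq_nonneg (y + z))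
  have n3 := mul_nonneg n (sq_nonneg (z + x))
  have e : ((x + y + z) * x) ^ 2 ≤ 2 * ((x + y) ^ 2 * x ^ 2) + 2 * (x * z) ^ 2 := by
    nlinarith [sq_nonneg ((x + y) * x - x * z)]
  nlinarith [sq_nonneg ((x + y) * (z + x))]

lemma Phi_eq (a b c : ℤ) : Phi a b c = 3 * ((a + b) * (b + c) * (c + a)) := by
  unfold Phi; ring

lemma inv_sq_le_jb_rpow {a : ℤ} (ha : a ≠ 0) : 1 / (a : ℝ) ^ 2 ≤ 4 * jb a ^ (-(2 : ℝ)) := by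
  have h1 : (1 : ℝ) ≤ |(a : ℝ)| := by exact_mod_cast Int.one_le_abs ha
  rw [Real.rpow_neg (jb_pos a).le, Real.rpow_two, ← sq_abs, ← div_eq_mul_inv,
    div_le_div_iff₀ (by positivity) (pow_pos (jb_pos a) 2)]
  unfold jb
  nlinarith

/-- The multiplier `k k₁ / Φ`, extended by zero to the resonant set. -/
noncomputable def realMult (k : ℤ) (p : ℤ × ℤ) : ℝ :=
  if Phi p.1 p.2 (k - p.1 - p.2) ≠ 0 then (k : ℝ) * p.1 / (Phi p.1 p.2 (k - p.1 - p.2) : ℤ) else 0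

lemma mult_eq (k : ℤ) (p : ℤ × ℤ) : mult k p = ‖realMult k p‖ₑ := by
  unfold mult realMult
  split_ifs
  · rw [← ofReal_norm, ← ofReal_norm]
    congr 1
    simp
  · simp

lemma realMult_sq_le {k : ℤ} {p : ℤ × ℤ} {q : ℝ} (hq : 0 ≤ q)
    (h : ((k : ℝ) * p.1) ^ 2 ≤ 5 * ((((p.1 : ℝ) + p.2) * (k - p.2)) ^ 2 +
      q * (((p.1 : ℝ) + p.2) ^ 2 + ((k : ℝ) - p.1) ^ 2 + ((k : ℝ) - p.2) ^ 2))) :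
    realMult k p ^ 2 ≤ 16 * (1 + q * pairSum k p) := by
  have hP := mul_nonneg hq (pairSum_nonneg k p)
  unfold realMult
  split_ifs with hΦ
  swap
  · nlinarith
  rw [Phi_eq] at hΦ ⊢
  have e1 : p.2 + (k - p.1 - p.2) = k - p.1 := by ring
  have e2 : k - p.1 - p.2 + p.1 = k - p.2 := by ring
  rw [e1, e2] at hΦ ⊢
  have ha : p.1 + p.2 ≠ 0 := by rintro h0; simp [h0] at hΦ
  have hc : k - p.1 ≠ 0 := by rintro h0; simp [h0] at hΦ
  have hb : k - p.2 ≠ 0 := by rintro h0; simp [h0] at hΦ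
  have Ia := inv_sq_le_jb_rpow ha
  have Ib := inv_sq_le_jb_rpow hb
  have Ic := inv_sq_le_jb_rpow hc
  have c1 : (1 : ℝ) ≤ ((k : ℝ) - p.1) ^ 2 := by
    have := Int.one_le_abs hc
    have : (1 : ℤ) ≤ (k - p.1) ^ 2 := by rw [← sq_abs]; nlinarith
    exact_mod_cast this
  have ha' : ((p.1 + p.2 : ℤ) : ℝ) ≠ 0 := by exact_mod_cast ha
  have hb' : ((k - p.2 : ℤ) : ℝ) ≠ 0 := by exact_mod_cast hb
  have hc' : ((k - p.1 : ℤ) : ℝ) ≠ 0 := by exact_mod_cast hc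
  have hS : 1 / ((k - p.1 : ℤ) : ℝ) ^ 2 * (1 / ((k - p.2 : ℤ) : ℝ) ^ 2) +
      1 / ((k - p.1 : ℤ) : ℝ) ^ 2 * (1 / ((p.1 + p.2 : ℤ) : ℝ) ^ 2) +
      1 / ((k - p.2 : ℤ) : ℝ) ^ 2 * (1 / ((p.1 + p.2 : ℤ) : ℝ) ^ 2) ≤ 16 * pairSum k p := by
    have nn : ∀ x : ℤ, 0 ≤ 4 * jb x ^ (-(2 : ℝ)) := fun x => by
      have := Real.rpow_nonneg (jb_pos x).le (-(2 : ℝ)); linarith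
    have m1 := mul_le_mul Ic Ib (by positivity) (nn _)
    have m2 := mul_le_mul Ic Ia (by positivity) (nn _)
    have m3 := mul_le_mul Ib Ia (by positivity) (nn _)
    unfold pairSum
    linarith
  have hS' := mul_le_mul_of_nonneg_left hS hq
  push_cast at ha' hb' hc' hS' ⊢
  set a := (p.1 : ℝ) + p.2
  set b := (k : ℝ) - p.2
  set c := (k : ℝ) - p.1
  have h9 : ((k : ℝ) * p.1) ^ 2 ≤ 5 * ((a * b * c) ^ 2 + q * (a ^ 2 + c ^ 2 + b ^ 2)) := by
    have : (a * b) ^ 2 ≤ (a * b * c) ^ 2 := by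
      rw [mul_pow (a * b) c]; exact le_mul_of_one_le_right (sq_nonneg _) c1
    linarith
  calc ((k : ℝ) * p.1 / (3 * (a * c * b))) ^ 2
      = ((k : ℝ) * p.1) ^ 2 / (9 * (a * b * c) ^ 2) := by rw [div_pow]; congr 1; ring
    _ ≤ 5 * ((a * b * c) ^ 2 + q * (a ^ 2 + c ^ 2 + b ^ 2)) / (9 * (a * b * c) ^ 2) := by
        gcongr
    _ = 5 / 9 * (1 + q * (1 / c ^ 2 * (1 / b ^ 2) + 1 / c ^ 2 * (1 / a ^ 2) +
          1 / b ^ 2 * (1 / a ^ 2))) := by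
        field_simp; ring
    _ ≤ 5 / 9 * (1 + q * (16 * pairSum k p)) := by linarith
    _ ≤ _ := by linarith

lemma exists_kernelBound_mult {s : ℝ} (hs : 1 / 2 < s) :
    ∃ B : ℝ≥0∞, B ≠ ⊤ ∧ KernelBound s mult B := by
  have e : mult = fun k p => ‖realMult k p‖ₑ := by
    funext k p; exact mult_eq k p
  rw [e]
  have habs : ∀ x : ℤ, |(x : ℝ)| ≤ jb x := fun x => by unfold jb; linarith
  have up : ∀ (x y k : ℤ) (p : ℤ × ℤ), 16 * (1 + |(x : ℝ)| * |(y : ℝ)| * pairSum k p) ≤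
      16 * (1 + jb x * jb y * pairSum k p) := fun x y k p => by
    have := pairSum_nonneg k p
    have := jb_pos x
    gcongr <;> apply habs
  refine exists_kernelBound hs (c := 16) (by norm_num) _ (fun k p => ?_) (fun k p => ?_)
    (fun k p => ?_)
  all_goals
    refine (realMult_sq_le (by positivity) ?_).trans (up _ _ _ _)
    push_cast
  · convert sq_sum_mul_le_right (p.1 : ℝ) p.2 (k - p.1 - p.2) using 4 <;> ring
  · convert sq_sum_mul_le_left (p.1 : ℝ) p.2 (k - p.1 - p.2) using 4 <;> ring
  · convert sq_sum_mul_le_left (p.1 : ℝ) (k - p.1 - p.2) p.2 using 4 <;> ring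

/-- Pointwise majorant of `‖v₁v₂v₃ - w₁w₂w₃‖` in terms of majorants `u` and `d` of the
factors and of their differences. -/
noncomputable def mulDiff (d₁ d₂ d₃ u₁ u₂ u₃ : ℝ≥0∞) : ℝ≥0∞ := d₁ * u₂ * u₃ + u₁ * d₂ * u₃ + u₁ * u₂ * d₃

lemma enorm_mul_sub_mul_le {a b c a' b' c' : ℂ} {d₁ d₂ d₃ u₁ u₂ u₃ : ℝ≥0∞}
    (ha : ‖a - a'‖ₑ ≤ d₁) (hb : ‖b - b'‖ₑ ≤ d₂) (hc : ‖c - c'‖ₑ ≤ d₃)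
    (ha' : ‖a'‖ₑ ≤ u₁) (h_b : ‖b‖ₑ ≤ u₂) (hb' : ‖b'‖ₑ ≤ u₂) (h_c : ‖c‖ₑ ≤ u₃) :
    ‖a * b * c - a' * b' * c'‖ₑ ≤ mulDiff d₁ d₂ d₃ u₁ u₂ u₃ := by
  have e : a * b * c - a' * b' * c' = (a - a') * b * c + a' * (b - b') * c + a' * b' * (c - c') := by
    ring
  rw [e, mulDiff]
  refine (enorm_add_le _ _).trans (add_le_add ((enorm_add_le _ _).trans (add_le_add ?_ ?_)) ?_) <;>
  · simp only [enorm_mul]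
    gcongr

/-- The cubic sequence majorizing the inner factor at frequency `k₁`. -/
noncomputable def cubicMaj (U : ℤ → ℝ≥0∞) (k : ℤ) : ℝ≥0∞ :=
  U k ^ 3 + trilin (fun _ _ => 1) U U U k

/-- The majorant of the variation of the inner factor at frequency `k₁`. -/
noncomputable def cubicDiffMaj (D U : ℤ → ℝ≥0∞) (k : ℤ) : ℝ≥0∞ :=
  3 * U k ^ 2 * D k + (trilin (fun _ _ => 1) D U U k + trilin (fun _ _ => 1) U D U k +
    trilin (fun _ _ => 1) U U D k)

/-- The majorant of the variation of `N₂`. -/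
noncomputable def diffMaj (D U : ℤ → ℝ≥0∞) (k : ℤ) : ℝ≥0∞ :=
  trilin mult (cubicDiffMaj D U) U U k + trilin mult (cubicMaj U) D U k +
    trilin mult (cubicMaj U) U D k

lemma enorm_exp_I_mul (x : ℝ) : ‖Complex.exp (Complex.I * x)‖ₑ = 1 := by
  rw [← ofReal_norm, mul_comm, Complex.norm_exp_ofReal_mul_I, ENNReal.ofReal_one]

lemma N2term1_factor (t : ℝ) (k : ℤ) (p : ℤ × ℤ) :
    ∃ c : ℂ, ‖c‖ₑ = mult k p ∧ ∀ v : ℤ → ℂ, N2term1 v t k p =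
      c * (((‖v p.1‖ : ℂ) ^ 2 * v p.1) * v p.2 * v (k - p.1 - p.2)) := by
  by_cases h : Phi p.1 p.2 (k - p.1 - p.2) ≠ 0
  · refine ⟨-(((k : ℂ) * (p.1 : ℂ)) / (Complex.I * ((Phi p.1 p.2 (k - p.1 - p.2) : ℤ) : ℂ))) *
      Complex.exp (Complex.I * (t : ℂ) * ((Phi p.1 p.2 (k - p.1 - p.2) : ℤ) : ℂ)), ?_, fun v => ?_⟩
    · rw [mult, if_pos h, enorm_mul, enorm_neg, mul_assoc Complex.I]
      have := enorm_exp_I_mul (t * (Phi p.1 p.2 (k - p.1 - p.2) : ℤ))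
      push_cast at this
      rw [this, mul_one]
    · rw [N2term1, if_pos h]; ring
  · exact ⟨0, by rw [mult, if_neg h, enorm_zero], fun v => by rw [N2term1, if_neg h, zero_mul]⟩

lemma N2term2_factor (t : ℝ) (k : ℤ) (q : ℤ × ℤ × ℤ × ℤ) :
    ∃ c : ℂ, ‖c‖ₑ ≤ mult k (q.1, q.2.1) ∧ ∀ v : ℤ → ℂ, N2term2 v t k q =
      c * ((v q.2.2.1 * v q.2.2.2 * v (q.1 - q.2.2.1 - q.2.2.2)) * v q.2.1 *
        v (k - q.1 - q.2.1)) := by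
  by_cases h : Phi q.1 q.2.1 (k - q.1 - q.2.1) ≠ 0 ∧
      Phi q.2.2.1 q.2.2.2 (q.1 - q.2.2.1 - q.2.2.2) ≠ 0
  · refine ⟨(1 / 3 : ℂ) *
      (((k : ℂ) * (q.1 : ℂ)) / (Complex.I * ((Phi q.1 q.2.1 (k - q.1 - q.2.1) : ℤ) : ℂ))) *
      Complex.exp (Complex.I * (t : ℂ) *
        (((Phi q.1 q.2.1 (k - q.1 - q.2.1) : ℤ) : ℂ) +
          ((Phi q.2.2.1 q.2.2.2 (q.1 - q.2.2.1 - q.2.2.2) : ℤ) : ℂ))), ?_, fun v => ?_⟩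
    · rw [mult, if_pos h.1, enorm_mul, enorm_mul, mul_assoc Complex.I]
      have := enorm_exp_I_mul (t * ((Phi q.1 q.2.1 (k - q.1 - q.2.1) : ℤ) +
        (Phi q.2.2.1 q.2.2.2 (q.1 - q.2.2.1 - q.2.2.2) : ℤ)))
      push_cast at this
      rw [this, mul_one]
      refine mul_le_of_le_one_left (by positivity) ?_
      rw [← ofReal_norm, ENNReal.ofReal_le_one]
      norm_num
    · rw [N2term2, if_pos h]; ring
  · exact ⟨0, by simp, fun v => by rw [N2term2, if_neg h, zero_mul]⟩

section Majorant

variable {v w : ℤ → ℂ} {D U : ℤ → ℝ≥0∞}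

lemma enorm_N2term1_sub_le (hD : ∀ k, ‖v k - w k‖ₑ ≤ D k) (hv : ∀ k, ‖v k‖ₑ ≤ U k)
    (hw : ∀ k, ‖w k‖ₑ ≤ U k) (t : ℝ) (k : ℤ) (p : ℤ × ℤ) :
    ‖N2term1 v t k p - N2term1 w t k p‖ₑ ≤ mult k p *
      mulDiff (3 * U p.1 ^ 2 * D p.1) (D p.2) (D (k - p.1 - p.2))
        (U p.1 ^ 3) (U p.2) (U (k - p.1 - p.2)) := by
  obtain ⟨c, hc, h⟩ := N2term1_factor t k p
  rw [h, h, ← mul_sub, enorm_mul, hc]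
  have conj : ∀ z : ℂ, (‖z‖ : ℂ) ^ 2 * z = z * z * starRingEnd ℂ z := fun z => by
    rw [← Complex.conj_mul']; ring
  have nc : ∀ z : ℂ, ‖starRingEnd ℂ z‖ₑ = ‖z‖ₑ := fun z => by
    rw [← ofReal_norm, ← ofReal_norm, Complex.norm_conj]
  gcongr
  refine enorm_mul_sub_mul_le ?_ (hD _) (hD _) ?_ (hv _) (hw _) (hv _)
  · rw [conj, conj]
    refine (enorm_mul_sub_mul_le (hD _) (hD _) (d₃ := D p.1) (u₃ := U p.1) ?_ (hw _) (hv _) (hw _)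
      ?_).trans (le_of_eq ?_)
    · rw [← map_sub, nc]; exact hD _
    · rw [nc]; exact hv _
    · unfold mulDiff; ring
  · rw [conj, enorm_mul, enorm_mul, nc, pow_three']
    gcongr <;> exact hw _

lemma enorm_N2term2_sub_le (hD : ∀ k, ‖v k - w k‖ₑ ≤ D k) (hv : ∀ k, ‖v k‖ₑ ≤ U k)
    (hw : ∀ k, ‖w k‖ₑ ≤ U k) (t : ℝ) (k : ℤ) (q : ℤ × ℤ × ℤ × ℤ) :
    ‖N2term2 v t k q - N2term2 w t k q‖ₑ ≤ mult k (q.1, q.2.1) *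
      mulDiff (mulDiff (D q.2.2.1) (D q.2.2.2) (D (q.1 - q.2.2.1 - q.2.2.2))
        (U q.2.2.1) (U q.2.2.2) (U (q.1 - q.2.2.1 - q.2.2.2))) (D q.2.1) (D (k - q.1 - q.2.1))
        (U q.2.2.1 * U q.2.2.2 * U (q.1 - q.2.2.1 - q.2.2.2)) (U q.2.1) (U (k - q.1 - q.2.1)) := by
  obtain ⟨c, hc, h⟩ := N2term2_factor t k q
  rw [h, h, ← mul_sub, enorm_mul]
  gcongr
  refine enorm_mul_sub_mul_le ?_ (hD _) (hD _) ?_ (hv _) (hw _) (hv _)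
  · exact enorm_mul_sub_mul_le (hD _) (hD _) (hD _) (hw _) (hv _) (hw _) (hv _)
  · rw [enorm_mul, enorm_mul]
    gcongr <;> exact hw _

lemma tsum_enorm_sub_le_diffMaj (hD : ∀ k, ‖v k - w k‖ₑ ≤ D k) (hv : ∀ k, ‖v k‖ₑ ≤ U k)
    (hw : ∀ k, ‖w k‖ₑ ≤ U k) (t : ℝ) (k : ℤ) :
    ∑' p, ‖N2term1 v t k p - N2term1 w t k p‖ₑ + ∑' q, ‖N2term2 v t k q - N2term2 w t k q‖ₑ ≤
      diffMaj D U k := by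
  have h₂ : ∑' q, ‖N2term2 v t k q - N2term2 w t k q‖ₑ ≤ ∑' p : ℤ × ℤ, mult k p *
      mulDiff (trilin (fun _ _ => 1) D U U p.1 + trilin (fun _ _ => 1) U D U p.1 +
        trilin (fun _ _ => 1) U U D p.1) (D p.2) (D (k - p.1 - p.2))
        (trilin (fun _ _ => 1) U U U p.1) (U p.2) (U (k - p.1 - p.2)) := by
    refine (ENNReal.tsum_le_tsum (enorm_N2term2_sub_le hD hv hw t k)).trans (le_of_eq ?_)
    rw [← (Equiv.prodAssoc ℤ ℤ (ℤ × ℤ)).tsum_eq]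
    simp only [Equiv.prodAssoc_apply]
    rw [ENNReal.tsum_prod (f := fun (p j : ℤ × ℤ) => mult k (p.1, p.2) *
      mulDiff (mulDiff (D j.1) (D j.2) (D (p.1 - j.1 - j.2)) (U j.1) (U j.2) (U (p.1 - j.1 - j.2)))
        (D p.2) (D (k - p.1 - p.2)) (U j.1 * U j.2 * U (p.1 - j.1 - j.2)) (U p.2)
        (U (k - p.1 - p.2)))]
    refine tsum_congr fun p => ?_
    simp only [mulDiff, trilin, one_mul, ENNReal.tsum_mul_left, ENNReal.tsum_mul_right,
      ENNReal.tsum_add]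
  refine (add_le_add (ENNReal.tsum_le_tsum (enorm_N2term1_sub_le hD hv hw t k)) h₂).trans
    (le_of_eq ?_)
  rw [← ENNReal.tsum_add, diffMaj]
  simp only [trilin.eq_1 mult, ← ENNReal.tsum_add]
  refine tsum_congr fun p => ?_
  simp only [mulDiff, cubicDiffMaj, cubicMaj]
  ring

end Majorant

lemma sobNorm_cubicMaj_le {s : ℝ} (hs : 0 ≤ s) {B : ℝ≥0∞} (hB : KernelBound s (fun _ _ => 1) B)
    (U : ℤ → ℝ≥0∞) : sobNorm s (cubicMaj U) ≤ (1 + B) * sobNorm s U ^ 3 := by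
  calc sobNorm s (cubicMaj U)
      ≤ sobNorm s (fun k => U k ^ 3) + sobNorm s (trilin (fun _ _ => 1) U U U) :=
        sobNorm_add_le s _ _
    _ ≤ sobNorm s (fun k => sobNorm s U ^ 2 * U k) +
          B * (sobNorm s U * sobNorm s U * sobNorm s U) := by
        refine add_le_add (sobNorm_mono fun k => ?_) (sobNorm_trilin_le hB _ _ _)
        rw [pow_succ]
        gcongr
        exact le_sobNorm hs U k
    _ = _ := by rw [sobNorm_const_mul]; ring

lemma sobNorm_cubicDiffMaj_le {s : ℝ} (hs : 0 ≤ s) {B : ℝ≥0∞}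
    (hB : KernelBound s (fun _ _ => 1) B) (D U : ℤ → ℝ≥0∞) :
    sobNorm s (cubicDiffMaj D U) ≤ 3 * (1 + B) * (sobNorm s U ^ 2 * sobNorm s D) := by
  have h₁ : sobNorm s (fun k => 3 * U k ^ 2 * D k) ≤ 3 * sobNorm s U ^ 2 * sobNorm s D := by
    rw [← sobNorm_const_mul]
    refine sobNorm_mono fun k => ?_
    gcongr
    exact le_sobNorm hs U k
  calc sobNorm s (cubicDiffMaj D U)
      ≤ sobNorm s (fun k => 3 * U k ^ 2 * D k) + (sobNorm s (trilin (fun _ _ => 1) D U U) +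
          sobNorm s (trilin (fun _ _ => 1) U D U) + sobNorm s (trilin (fun _ _ => 1) U U D)) :=
        (sobNorm_add_le s _ _).trans (add_le_add le_rfl ((sobNorm_add_le s _ _).trans
          (add_le_add (sobNorm_add_le s _ _) le_rfl)))
    _ ≤ 3 * sobNorm s U ^ 2 * sobNorm s D + (B * (sobNorm s D * sobNorm s U * sobNorm s U) +
          B * (sobNorm s U * sobNorm s D * sobNorm s U) +
          B * (sobNorm s U * sobNorm s U * sobNorm s D)) := by
        gcongr <;> exact sobNorm_trilin_le hB _ _ _
    _ = _ := by ring

lemma sobNorm_diffMaj_le {s : ℝ} (hs : 0 ≤ s) {A B : ℝ≥0∞} (hA : KernelBound s mult A)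
    (hB : KernelBound s (fun _ _ => 1) B) (D U : ℤ → ℝ≥0∞) :
    sobNorm s (diffMaj D U) ≤ 5 * (A * (1 + B)) * (sobNorm s U ^ 4 * sobNorm s D) := by
  calc sobNorm s (diffMaj D U)
      ≤ sobNorm s (trilin mult (cubicDiffMaj D U) U U) +
          sobNorm s (trilin mult (cubicMaj U) D U) + sobNorm s (trilin mult (cubicMaj U) U D) :=
        (sobNorm_add_le s _ _).trans (add_le_add (sobNorm_add_le s _ _) le_rfl)
    _ ≤ A * (sobNorm s (cubicDiffMaj D U) * sobNorm s U * sobNorm s U) +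
          A * (sobNorm s (cubicMaj U) * sobNorm s D * sobNorm s U) +
          A * (sobNorm s (cubicMaj U) * sobNorm s U * sobNorm s D) := by
        gcongr <;> exact sobNorm_trilin_le hA _ _ _
    _ ≤ A * (3 * (1 + B) * (sobNorm s U ^ 2 * sobNorm s D) * sobNorm s U * sobNorm s U) +
          A * ((1 + B) * sobNorm s U ^ 3 * sobNorm s D * sobNorm s U) +
          A * ((1 + B) * sobNorm s U ^ 3 * sobNorm s U * sobNorm s D) := by
        gcongr
        · exact sobNorm_cubicDiffMaj_le hs hB D U
        · exact sobNorm_cubicMaj_le hs hB U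
        · exact sobNorm_cubicMaj_le hs hB U
    _ = _ := by ring

/-- `N₂(v)(t)_k` with both sums restricted to the frequencies `(k₁, k₂)` satisfying `P`. -/
noncomputable def restrictedN2 (P : ℤ × ℤ → Prop) [DecidablePred P] (v : ℤ → ℂ) (t : ℝ) (k : ℤ) :
    ℂ :=
  (∑' p : ℤ × ℤ, if P p then N2term1 v t k p else 0) +
    ∑' q : ℤ × ℤ × ℤ × ℤ, if P (q.1, q.2.1) then N2term2 v t k q else 0

lemma N2term1_zero (t : ℝ) (k : ℤ) (p : ℤ × ℤ) : N2term1 (fun _ => 0) t k p = 0 := by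
  simp [N2term1]

lemma N2term2_zero (t : ℝ) (k : ℤ) (q : ℤ × ℤ × ℤ × ℤ) : N2term2 (fun _ => 0) t k q = 0 := by
  simp [N2term2]

lemma restrictedN2_zero (P : ℤ × ℤ → Prop) [DecidablePred P] (t : ℝ) (k : ℤ) :
    restrictedN2 P (fun _ => 0) t k = 0 := by
  simp [restrictedN2, N2term1_zero, N2term2_zero]

lemma summable_of_diffMaj_ne_top {v : ℤ → ℂ} {k : ℤ}
    (h : diffMaj (fun k => ‖v k‖ₑ) (fun k => ‖v k‖ₑ) k ≠ ⊤) (P : ℤ × ℤ → Prop) [DecidablePred P]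
    (t : ℝ) : (Summable fun p => if P p then N2term1 v t k p else 0) ∧
      Summable fun q : ℤ × ℤ × ℤ × ℤ => if P (q.1, q.2.1) then N2term2 v t k q else 0 := by
  have := tsum_enorm_sub_le_diffMaj (v := v) (w := fun _ => 0) (D := fun k => ‖v k‖ₑ)
    (U := fun k => ‖v k‖ₑ) (by simp) (by simp) (by simp) t k
  simp only [N2term1_zero, N2term2_zero, sub_zero] at this
  constructor
  · refine Summable.of_enorm (ne_top_of_le_ne_top h (le_trans (ENNReal.tsum_le_tsum fun p => ?_)
      (le_self_add.trans this)))
    split_ifs <;> simp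
  · refine Summable.of_enorm (ne_top_of_le_ne_top h (le_trans (ENNReal.tsum_le_tsum fun p => ?_)
      (le_add_self.trans this)))
    split_ifs <;> simp

lemma enorm_restrictedN2_sub_le {v w : ℤ → ℂ} {D U : ℤ → ℝ≥0∞} {k : ℤ}
    (hD : ∀ k, ‖v k - w k‖ₑ ≤ D k) (hv : ∀ k, ‖v k‖ₑ ≤ U k) (hw : ∀ k, ‖w k‖ₑ ≤ U k)
    (hv' : diffMaj (fun k => ‖v k‖ₑ) (fun k => ‖v k‖ₑ) k ≠ ⊤)
    (hw' : diffMaj (fun k => ‖w k‖ₑ) (fun k => ‖w k‖ₑ) k ≠ ⊤)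
    (P : ℤ × ℤ → Prop) [DecidablePred P] (t : ℝ) :
    ‖restrictedN2 P v t k - restrictedN2 P w t k‖ₑ ≤ diffMaj D U k := by
  obtain ⟨v₁, v₂⟩ := summable_of_diffMaj_ne_top hv' P t
  obtain ⟨w₁, w₂⟩ := summable_of_diffMaj_ne_top hw' P t
  unfold restrictedN2
  rw [add_sub_add_comm, ← v₁.tsum_sub w₁, ← v₂.tsum_sub w₂]
  refine (enorm_add_le _ _).trans (le_trans (add_le_add ?_ ?_)
    (tsum_enorm_sub_le_diffMaj hD hv hw t k)) <;>
  · refine enorm_tsum_le_tsum_enorm.trans (ENNReal.tsum_le_tsum fun p => ?_)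
    split_ifs <;> simp

lemma hnorm_restrictedN2_sub_le {s : ℝ} (hs : 0 ≤ s) {A B : ℝ≥0∞} (hA : KernelBound s mult A)
    (hB : KernelBound s (fun _ _ => 1) B) (hA' : A ≠ ⊤) (hB' : B ≠ ⊤) {v w : ℤ → ℂ}
    (hv : hnorm s v < ⊤) (hw : hnorm s w < ⊤) (P : ℤ → ℤ × ℤ → Prop) [∀ k, DecidablePred (P k)]
    (t : ℝ) :
    hnorm s (fun k => restrictedN2 (P k) v t k - restrictedN2 (P k) w t k) ≤
      5 * (A * (1 + B)) * ((hnorm s v + hnorm s w) ^ 4 * hnorm s (fun k => v k - w k)) := by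
  have fin : ∀ u : ℤ → ℂ, hnorm s u < ⊤ → ∀ k,
      diffMaj (fun k => ‖u k‖ₑ) (fun k => ‖u k‖ₑ) k ≠ ⊤ := fun u hu k => by
    rw [hnorm_eq_sobNorm] at hu
    have hu' := hu.ne
    refine ne_top_of_le_ne_top ?_ ((le_sobNorm hs _ k).trans (sobNorm_diffMaj_le hs hA hB _ _))
    finiteness
  simp only [hnorm_eq_sobNorm]
  refine (sobNorm_mono fun k => enorm_restrictedN2_sub_le (D := fun k => ‖v k - w k‖ₑ)
    (U := fun k => ‖v k‖ₑ + ‖w k‖ₑ) (fun _ => le_rfl) (fun _ => le_self_add) (fun _ => le_add_self)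
    (fin v hv k) (fin w hw k) (P k) t).trans ((sobNorm_diffMaj_le hs hA hB _ _).trans ?_)
  gcongr
  exact sobNorm_add_le s _ _

/-- Estimates for `N₂^{(-n)}` (uniformly in `n`) and for `N₂`, for `s > 1/2`. -/
theorem N2_estimates (s : ℝ) (hs : 1 / 2 < s) :
    ∃ C > (0 : ℝ), ∀ t : ℝ, ∀ v w : ℤ → ℂ, hnorm s v < ⊤ → hnorm s w < ⊤ →
      (∀ n : ℕ,
        hnorm s (fun k => N2n n v t k) ≤ ENNReal.ofReal C * hnorm s v ^ 5 ∧
        hnorm s (fun k => N2n n v t k - N2n n w t k) ≤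
          ENNReal.ofReal C * (hnorm s v + hnorm s w) ^ 4 *
            hnorm s (fun k => v k - w k)) ∧
      (hnorm s (fun k => N2 v t k) ≤ ENNReal.ofReal C * hnorm s v ^ 5 ∧
        hnorm s (fun k => N2 v t k - N2 w t k) ≤
          ENNReal.ofReal C * (hnorm s v + hnorm s w) ^ 4 *
            hnorm s (fun k => v k - w k)) := by
  have hs0 : 0 ≤ s := by linarith
  obtain ⟨A, hAt, hA⟩ := exists_kernelBound_mult hs
  obtain ⟨B, hBt, hB⟩ := exists_kernelBound_one hs
  have hK : 5 * (A * (1 + B)) ≠ ⊤ := by finiteness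
  refine ⟨(5 * (A * (1 + B))).toReal + 1, by positivity, fun t v w hv hw => ?_⟩
  have hC : 5 * (A * (1 + B)) ≤ ENNReal.ofReal ((5 * (A * (1 + B))).toReal + 1) :=
    (ENNReal.ofReal_toReal hK).symm.le.trans (ENNReal.ofReal_le_ofReal (by linarith))
  set C := ENNReal.ofReal ((5 * (A * (1 + B))).toReal + 1)
  have diff : ∀ (P : ℤ → ℤ × ℤ → Prop) [∀ k, DecidablePred (P k)] (u : ℤ → ℂ), hnorm s u < ⊤ →
      hnorm s (fun k => restrictedN2 (P k) v t k - restrictedN2 (P k) u t k) ≤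
        C * (hnorm s v + hnorm s u) ^ 4 * hnorm s (fun k => v k - u k) := fun P _ u hu => by
    rw [mul_assoc]
    exact (hnorm_restrictedN2_sub_le hs0 hA hB hAt hBt hv hu P t).trans (by gcongr)
  have zero : hnorm s (fun _ => 0) = 0 := by simp [hnorm]
  have bound : ∀ (P : ℤ → ℤ × ℤ → Prop) [∀ k, DecidablePred (P k)],
      hnorm s (fun k => restrictedN2 (P k) v t k) ≤ C * hnorm s v ^ 5 := fun P _ => by
    have := diff P (fun _ => 0) (by simp [zero])
    simp only [restrictedN2_zero, sub_zero, zero, add_zero] at this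
    rwa [mul_assoc, ← pow_succ] at this
  have full : ∀ u k, N2 u t k = restrictedN2 (fun _ => True) u t k := fun u k => by
    simp [N2, restrictedN2]
  refine ⟨fun n => ?_, ?_⟩
  · let P : ℤ → ℤ × ℤ → Prop := fun k p => (n : ℤ) < max (max |p.1| |p.2|) |k - p.1 - p.2|
    let _ : ∀ k, DecidablePred (P k) := fun k p => Int.decLt _ _
    exact ⟨bound P, diff P w hw⟩
  · simp only [full]
    exact ⟨bound fun _ _ => True, diff (fun _ _ => True) w hw⟩
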